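/- arXiv:1603.09090 — 4 statements merged into one kernel-verified Lean document; each statement's English description precedes it below -/
import Mathlib

section
/- Each party computes the same key: for every index i (taken modulo n), the value K_i = z_{i-1}^{n·r_i} · X_i^{n-1} · X_{i+1}^{n-2} · ... · X_{i+n-2}^{1} equals g^{r_1·r_2 + r_2·r_3 + ... + r_{n-1}·r_n + r_n·r_1}. -/
theorem pow_zmod_val_natCast {G : Type*} [Monoid G] {q : ℕ} {g : G} (h : g ^ q = 1) (k : ℕ) :
    g ^ (k : ZMod q).val = g ^ k := by
  rw [ZMod.val_natCast, ← pow_eq_pow_mod k h]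

/-- The homomorphism `a ↦ g ^ a` on exponents modulo `q`, for `g ^ q = 1`. -/
def zmodPowHom {G : Type*} [Monoid G] {q : ℕ} [NeZero q] {g : G} (h : g ^ q = 1) :
    Multiplicative (ZMod q) →* G where
  toFun a := g ^ a.toAdd.val
  map_one' := by simp
  map_mul' a b := by
    rw [toAdd_mul, ZMod.val_add, ← pow_eq_pow_mod _ h, pow_add]

theorem pow_zmod_val_sub {G : Type*} [Group G] {q : ℕ} [NeZero q] {g : G} (h : g ^ q = 1)
    (a b : ZMod q) : g ^ (a - b).val = g ^ a.val / g ^ b.val :=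
  map_div (zmodPowHom h) (Multiplicative.ofAdd a) (Multiplicative.ofAdd b)

theorem pow_zmod_val_add {G : Type*} [Monoid G] {q : ℕ} [NeZero q] {g : G} (h : g ^ q = 1)
    (a b : ZMod q) : g ^ (a + b).val = g ^ a.val * g ^ b.val :=
  map_mul (zmodPowHom h) (Multiplicative.ofAdd a) (Multiplicative.ofAdd b)

theorem pow_zmod_val_sum {G ι : Type*} [CommMonoid G] {q : ℕ} [NeZero q] {g : G} (h : g ^ q = 1)
    (s : Finset ι) (f : ι → ZMod q) :
    g ^ (∑ j ∈ s, f j).val = ∏ j ∈ s, g ^ (f j).val :=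
  map_prod (zmodPowHom h) (fun j => Multiplicative.ofAdd (f j)) s

theorem pow_zmod_val_mul {G : Type*} [Monoid G] {q : ℕ} {g : G} (h : g ^ q = 1)
    (a b : ZMod q) : g ^ (a * b).val = (g ^ a.val) ^ b.val := by
  rw [ZMod.val_mul, ← pow_eq_pow_mod _ h, pow_mul]

theorem pow_zmod_val_mul_natCast {G : Type*} [Monoid G] {q : ℕ} {g : G} (h : g ^ q = 1)
    (a : ZMod q) (k : ℕ) : g ^ (a * k).val = (g ^ a.val) ^ k := by
  rw [pow_zmod_val_mul h, pow_zmod_val_natCast]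
  rw [← pow_mul, mul_comm, pow_mul, h, one_pow]

/-- Summation by parts against the weights `m, m - 1, …, 1`. -/
theorem mul_add_sum_range_weighted_sub {R : Type*} [CommRing R] (s : ℕ → R) (m : ℕ) :
    s 0 * (m + 1 : ℕ) + ∑ j ∈ Finset.range m, (s (j + 1) - s j) * (m - j : ℕ) =
      ∑ j ∈ Finset.range (m + 1), s j := by
  induction m with
  | zero => simp
  | succ m ih =>
    have hw : ∑ j ∈ Finset.range (m + 1), (s (j + 1) - s j) * (m + 1 - j : ℕ) =
        ∑ j ∈ Finset.range m, (s (j + 1) - s j) * (m - j : ℕ) + (s (m + 1) - s 0) := by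
      rw [← Finset.sum_range_sub, Finset.sum_range_succ, Finset.sum_range_succ _ m, ← add_assoc,
        ← Finset.sum_add_distrib]
      congr 1
      · refine Finset.sum_congr rfl fun j hj => ?_
        rw [Nat.sub_add_comm (Finset.mem_range.mp hj).le]
        push_cast
        ring
      · simp
    rw [hw, Finset.sum_range_succ _ (m + 1), ← ih]
    push_cast
    ring

theorem sum_range_zmod_natCast {M : Type*} [AddCommMonoid M] (n : ℕ) [NeZero n]
    (f : ZMod n → M) : ∑ j ∈ Finset.range n, f j = ∑ t, f t :=
  Finset.sum_bij' (fun j _ => (j : ZMod n)) (fun t _ => t.val) (by simp)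
    (fun t _ => Finset.mem_range.mpr t.val_lt)
    (fun j hj => ZMod.val_cast_of_lt (Finset.mem_range.mp hj)) (by simp) (by simp)


/-- Burmester–Desmedt GKE: each party `U i` computes the key
`K_i = z_{i-1}^{n·r_i} · X_i^{n-1} · X_{i+1}^{n-2} ⋯ X_{i+n-2}^{1}`,
and this equals `g^{r_1 r_2 + r_2 r_3 + ⋯ + r_n r_1}`.
Exponentiation by an element `e : ZMod q` is modeled as `x ^ e.val`,
which is well defined since `G` has order `q`. -/
theorem burmester_desmedt_key_computation
    {G : Type*} [CommGroup G] (q : ℕ) [Fact q.Prime] (hG : Nat.card G = q)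
    (g : G) (hg : ∀ x : G, x ∈ Subgroup.zpowers g)
    (n : ℕ) [NeZero n] (hn : 2 ≤ n)
    (r : ZMod n → ZMod q)
    (z : ZMod n → G) (hz : ∀ i, z i = g ^ (r i).val)
    (X : ZMod n → G) (hX : ∀ i, X i = (z (i + 1) / z (i - 1)) ^ (r i).val)
    (i : ZMod n) :
    z (i - 1) ^ (((n : ZMod q) * r i).val) *
        ∏ j ∈ Finset.range (n - 1), X (i + (j : ZMod n)) ^ (n - 1 - j)
      = g ^ ((∑ t : ZMod n, r t * r (t + 1)).val) := by
  have h : g ^ q = 1 := by rw [← hG, pow_card_eq_one']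
  have hXe (t : ZMod n) : X t = g ^ (r t * r (t + 1) - r (t - 1) * r t).val := by
    rw [hX, hz, hz, ← pow_zmod_val_sub h, ← pow_zmod_val_mul h]
    congr 2
    ring
  obtain ⟨m, rfl⟩ : ∃ m, n = m + 1 := ⟨n - 1, by omega⟩
  let f : ZMod (m + 1) → ZMod q := fun t => r (i - 1 + t) * r (i - 1 + t + 1)
  have hXf (j : ℕ) : X (i + j) = g ^ (f (j + 1 : ℕ) - f j).val := by
    rw [hXe]
    simp only [f]
    push_cast
    congr 2
    ring_nf
  have hsum : ∑ t, f t = ∑ t, r t * r (t + 1) :=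
    Equiv.sum_comp (Equiv.addLeft (i - 1)) fun t => r t * r (t + 1)
  have hf0 : r (i - 1) * (((m + 1 : ℕ) : ZMod q) * r i) = f (0 : ℕ) * (m + 1 : ℕ) := by
    simp only [f, Nat.cast_zero, add_zero, sub_add_cancel]
    ring
  simp only [hXf, ← pow_zmod_val_mul_natCast h, Nat.add_sub_cancel]
  rw [hz, ← pow_zmod_val_mul h, ← pow_zmod_val_sum h, ← pow_zmod_val_add h, hf0,
    mul_add_sum_range_weighted_sub (fun j : ℕ => f j), sum_range_zmod_natCast, hsum]
end

section
/- All parties agree on a common key: for any two indices i and j (taken modulo n), the values K_i = z_{i-1}^{n·r_i} · X_i^{n-1} · X_{i+1}^{n-2} · ... · X_{i+n-2}^{1} and K_j = z_{j-1}^{n·r_j} · X_j^{n-1} · X_{j+1}^{n-2} · ... · X_{j+n-2}^{1} are equal. -/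
/-- Weighted telescoping of a product of consecutive quotients. -/
theorem pow_mul_prod_div_pow_eq_prod_range {G : Type*} [CommGroup G] (f : ℕ → G) (m : ℕ) :
    f 0 ^ (m + 1) * ∏ t ∈ Finset.range m, (f (t + 1) / f t) ^ (m - t)
      = ∏ t ∈ Finset.range (m + 1), f t := by
  induction m with
  | zero => simp
  | succ m ih =>
    have h : ∏ t ∈ Finset.range (m + 1), (f (t + 1) / f t) ^ (m + 1 - t)
        = (∏ t ∈ Finset.range m, (f (t + 1) / f t) ^ (m - t)) * (f (m + 1) / f 0) := by
      rw [← Finset.prod_range_div f (m + 1), Finset.prod_range_succ, Finset.prod_range_succ _ m,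
        ← mul_assoc, ← Finset.prod_mul_distrib]
      congr 1
      · refine Finset.prod_congr rfl fun t ht => ?_
        rw [← pow_succ, Nat.sub_add_comm (Finset.mem_range.mp ht).le]
      · simp
    rw [h, Finset.prod_range_succ, ← ih, pow_succ (f 0) (m + 1)]
    simp only [div_eq_mul_inv, mul_assoc, mul_comm, mul_left_comm, mul_inv_cancel_left]

theorem ZMod.prod_range_natCast {M : Type*} [CommMonoid M] (n : ℕ) [NeZero n] (f : ZMod n → M) :
    ∏ t ∈ Finset.range n, f t = ∏ a, f a :=
  Finset.prod_bij' (fun t _ => (t : ZMod n)) (fun a _ => a.val) (by simp)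
    (fun a _ => Finset.mem_range.mpr a.val_lt)
    (fun t ht => ZMod.val_cast_of_lt (Finset.mem_range.mp ht)) (by simp) (by simp)

theorem pow_val_natCast_mul {G : Type*} [Group G] {q : ℕ} (hG : Nat.card G = q)
    (x : G) (n : ℕ) (a : ZMod q) : x ^ ((n : ZMod q) * a).val = (x ^ a.val) ^ n := by
  have hx : x ^ q = 1 := hG ▸ pow_card_eq_one'
  rw [ZMod.val_mul, ZMod.val_natCast, Nat.mod_mul_mod, ← pow_mul, mul_comm a.val,
    ← pow_mod_orderOf, Nat.mod_mod_of_dvd _ (orderOf_dvd_of_pow_eq_one hx), pow_mod_orderOf]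

/-- Burmester–Desmedt GKE: any two parties `U i` and `U j` compute the same key,
i.e. `K_i = z_{i-1}^{n·r_i} · X_i^{n-1} · X_{i+1}^{n-2} ⋯ X_{i+n-2}^{1}` coincides
with the corresponding value `K_j`. Exponentiation by `e : ZMod q` is modeled as
`x ^ e.val`, well defined since `G` has order `q`. -/
theorem burmester_desmedt_common_key
    {G : Type*} [CommGroup G] (q : ℕ) [Fact q.Prime] (hG : Nat.card G = q)
    (g : G) (hg : ∀ x : G, x ∈ Subgroup.zpowers g)
    (n : ℕ) [NeZero n] (hn : 2 ≤ n)
    (r : ZMod n → ZMod q)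
    (z : ZMod n → G) (hz : ∀ i, z i = g ^ (r i).val)
    (X : ZMod n → G) (hX : ∀ i, X i = (z (i + 1) / z (i - 1)) ^ (r i).val)
    (i j : ZMod n) :
    z (i - 1) ^ (((n : ZMod q) * r i).val) *
        ∏ t ∈ Finset.range (n - 1), X (i + (t : ZMod n)) ^ (n - 1 - t)
      = z (j - 1) ^ (((n : ZMod q) * r j).val) *
        ∏ t ∈ Finset.range (n - 1), X (j + (t : ZMod n)) ^ (n - 1 - t) := by
  set Y : ZMod n → G := fun k => z (k - 1) ^ (r k).val with hY
  have hXY (k : ZMod n) : X k = Y (k + 1) / Y k := by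
    simp only [hY, hX, div_pow, add_sub_cancel_right, hz, ← pow_mul, mul_comm]
  have key (k : ZMod n) : z (k - 1) ^ (((n : ZMod q) * r k).val) *
      ∏ t ∈ Finset.range (n - 1), X (k + (t : ZMod n)) ^ (n - 1 - t) = ∏ a, Y a := by
    have h := pow_mul_prod_div_pow_eq_prod_range (fun t : ℕ => Y (k + t)) (n - 1)
    rw [Nat.sub_add_cancel (by lia : 1 ≤ n), ZMod.prod_range_natCast n (fun a => Y (k + a)),
      Fintype.prod_equiv (Equiv.addLeft k) (fun a => Y (k + a)) Y fun _ => rfl] at h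
    rw [pow_val_natCast_mul hG, ← h]
    simp [hXY, hY, add_assoc]
  rw [key, key]
end

section
/- In a proper execution of the protocol, the product of all broadcast values in the second round equals the identity: ∏_{i=1}^{n} X_i = 1. -/
/-- Burmester–Desmedt GKE: in a proper execution of the protocol, the product of
all values broadcast in the second round is the identity: `∏_{i=1}^{n} X_i = 1`.
Exponentiation by `e : ZMod q` is modeled as `x ^ e.val`, well defined since `G`
has order `q`. -/
theorem burmester_desmedt_product_eq_one
    {G : Type*} [CommGroup G] (q : ℕ) [Fact q.Prime] (hG : Nat.card G = q)
    (g : G) (hg : ∀ x : G, x ∈ Subgroup.zpowers g)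
    (n : ℕ) [NeZero n] (hn : 2 ≤ n)
    (r : ZMod n → ZMod q)
    (z : ZMod n → G) (hz : ∀ i, z i = g ^ (r i).val)
    (X : ZMod n → G) (hX : ∀ i, X i = (z (i + 1) / z (i - 1)) ^ (r i).val) :
    ∏ i : ZMod n, X i = 1 := by
  have hF (i : ZMod n) : X i = g ^ ((r i).val * (r (i + 1)).val) /
      g ^ ((r (i - 1)).val * (r (i - 1 + 1)).val) := by
    rw [hX, hz, hz, div_pow, ← pow_mul, ← pow_mul, sub_add_cancel, mul_comm (r i).val]
  simp_rw [hF]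
  rw [Finset.prod_div_distrib, div_eq_one]
  exact ((Equiv.subRight (1 : ZMod n)).prod_comp
    fun i ↦ g ^ ((r i).val * (r (i + 1)).val)).symm
end

section
/- After the active attack, the attacked user U_k computes the same key K as the attacker: with the values X_k, X_{k+1}, ..., X_{k+n-3}, X_{k-2} supplied by the attacker as in the attack description, it holds that K_k = z_{k-1}^{n·r_k} · X_k^{n-1} · X_{k+1}^{n-2} · ... · X_{k+n-3}^{2} · X_{k-2}^{1} = K. -/
/-- In a group of order `q`, exponentiation by a residue does not depend on its integer
representative. -/
theorem pow_zmod_val_eq_zpow {G : Type*} [Group G] {q : ℕ} [NeZero q] (hG : Nat.card G = q)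
    (x : G) {e : ZMod q} {m : ℤ} (hm : (m : ZMod q) = e) : x ^ e.val = x ^ m := by
  rw [← zpow_natCast, zpow_eq_zpow_iff_modEq]
  refine Int.ModEq.of_dvd (n := (q : ℤ)) ?_ ?_
  · exact_mod_cast hG ▸ orderOf_dvd_natCard x
  · rw [← ZMod.intCast_eq_intCast_iff]
    simp [hm]

/-- Summation by parts for the decreasing powers of a telescoping sequence of quotients. -/
theorem pow_mul_prod_range_inv_mul_pow {G : Type*} [CommGroup G] (m : ℕ) (f : ℕ → G) :
    f 0 ^ (m + 2) * ∏ j ∈ Finset.range m, ((f j)⁻¹ * f (j + 1)) ^ (m + 1 - j)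
      = f m ^ 2 * ∏ j ∈ Finset.range m, f j := by
  induction m generalizing f with
  | zero => simp
  | succ m ih =>
    have ih' := ih fun j => f (j + 1)
    rw [Finset.prod_range_succ', Finset.prod_range_succ' f, ← mul_assoc (f (m + 1) ^ 2), ← ih']
    simp only [show ∀ j, m + 1 + 1 - (j + 1) = m + 1 - j by omega, Nat.sub_zero, zero_add]
    generalize ∏ j ∈ Finset.range m, ((f (j + 1))⁻¹ * f (j + 1 + 1)) ^ (m + 1 - j) = P
    apply Additive.ofMul.injective
    simp only [mul_pow, inv_pow, pow_succ, ofMul_mul, ofMul_inv]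
    abel

/-- After the active attack on the Burmester–Desmedt GKE protocol, the attacked
user `U k` computes the attacker's key `K`: with the round-2 values
`X_k = z_{k-1}^{r_k(a-1)}`, `X_{k+1} = z_{k-1}^{-r_k} h_1`,
`X_{k+j} = h_{j-1}⁻¹ h_j` for `j = 2, …, n-3`, and
`X_{k-2} = K · X_k^{-(n-1)} · z_{k-1}^{-2 r_k} · h_{n-3}^{-2} · ∏_{t=1}^{n-4} h_t⁻¹`
supplied by the attacker, we get
`K_k = z_{k-1}^{n r_k} · X_k^{n-1} · X_{k+1}^{n-2} ⋯ X_{k+n-3}^{2} · X_{k-2}^{1} = K`.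
Exponentiation by `e : ZMod q` is modeled as `x ^ e.val`, well defined since `G`
has order `q`. -/
theorem burmester_desmedt_attack_key
    {G : Type*} [CommGroup G] (q : ℕ) [Fact q.Prime] (hG : Nat.card G = q)
    (g : G) (hg : ∀ x : G, x ∈ Subgroup.zpowers g)
    (n : ℕ) [NeZero n] (hn : 4 ≤ n) (k : ZMod n)
    (rkm1 rk : ZMod q) (a : ZMod q) (ha : IsUnit (a - 1))
    (K : G) (h : ℕ → G)
    (zkm1 : G) (hz : zkm1 = g ^ rkm1.val)
    (X : ZMod n → G)
    (hXk : X k = zkm1 ^ (rk * (a - 1)).val)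
    (hXk1 : X (k + 1) = zkm1 ^ (-rk).val * h 1)
    (hXmid : ∀ j : ℕ, 2 ≤ j → j ≤ n - 3 →
      X (k + (j : ZMod n)) = (h (j - 1))⁻¹ * h j)
    (hXkm2 : X (k - 2) = K * X k ^ (-(n - 1 : ℤ)) * zkm1 ^ (-(2 * rk)).val *
      h (n - 3) ^ (-2 : ℤ) * ∏ t ∈ Finset.Icc 1 (n - 4), (h t)⁻¹) :
    zkm1 ^ (((n : ZMod q) * rk).val) *
        ∏ j ∈ Finset.range (n - 1), X (k + (j : ZMod n)) ^ (n - 1 - j)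
      = K := by
  obtain ⟨m, rfl⟩ : ∃ m, n = m + 4 := ⟨n - 4, by omega⟩
  have hneg : zkm1 ^ (-rk).val = (zkm1 ^ rk.val)⁻¹ := by
    rw [pow_zmod_val_eq_zpow hG zkm1 (m := -(rk.val : ℤ)) (by simp), zpow_neg, zpow_natCast]
  have hneg2 : zkm1 ^ (-(2 * rk)).val = ((zkm1 ^ rk.val) ^ 2)⁻¹ := by
    rw [pow_zmod_val_eq_zpow hG zkm1 (m := -((rk.val * 2 : ℕ) : ℤ)) (by simp [mul_comm]),
      zpow_neg, zpow_natCast, pow_mul]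
  have hmul : zkm1 ^ (((m + 4 : ℕ) : ZMod q) * rk).val = (zkm1 ^ rk.val) ^ (m + 4) := by
    rw [pow_zmod_val_eq_zpow hG zkm1 (m := ((rk.val * (m + 4) : ℕ) : ℤ)) (by simp [mul_comm]),
      zpow_natCast, pow_mul]
  have hlast : k + ((m + 2 : ℕ) : ZMod (m + 4)) = k - 2 := by
    have h0 : ((m + 4 : ℕ) : ZMod (m + 4)) = 0 := ZMod.natCast_self _
    push_cast at h0 ⊢
    linear_combination h0
  have hmid : ∏ j ∈ Finset.range m,
        X (k + ((j + 1 + 1 : ℕ) : ZMod (m + 4))) ^ (m + 3 - (j + 1 + 1))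
      = ∏ j ∈ Finset.range m, ((h (j + 1))⁻¹ * h (j + 1 + 1)) ^ (m + 1 - j) := by
    refine Finset.prod_congr rfl fun j hj => ?_
    have hjm := Finset.mem_range.mp hj
    rw [hXmid (j + 1 + 1) (by omega) (by omega)]
    congr 1
    omega
  have habel := pow_mul_prod_range_inv_mul_pow m fun j => h (j + 1)
  have hIcc : ∏ t ∈ Finset.Icc 1 m, (h t)⁻¹ = (∏ j ∈ Finset.range m, h (j + 1))⁻¹ := by
    rw [Finset.prod_inv_distrib, Finset.range_eq_Ico, Finset.prod_Ico_add' h 0 m 1]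
    rfl
  have hexp : (-(((m + 4 : ℕ) : ℤ) - 1)) = -((m + 3 : ℕ) : ℤ) := by push_cast; ring
  rw [hexp, zpow_neg, zpow_natCast, hneg2, show m + 4 - 3 = m + 1 by omega,
    Nat.add_sub_cancel, hIcc, zpow_neg, zpow_ofNat] at hXkm2
  rw [hneg] at hXk1
  rw [hmul, show m + 4 - 1 = m + 2 + 1 by omega, Finset.prod_range_succ, hlast,
    Finset.prod_range_succ', Finset.prod_range_succ', hmid, hXkm2]
  simp only [zero_add, Nat.cast_zero, Nat.cast_one, add_zero, hXk1, Nat.sub_zero,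
    Nat.add_sub_cancel_left, Nat.add_sub_cancel, pow_one] at habel ⊢
  generalize zkm1 ^ rk.val = w at *
  generalize X k = x at *
  generalize (∏ j ∈ Finset.range m, ((h (j + 1))⁻¹ * h (j + 1 + 1)) ^ (m + 1 - j)) = P at *
  generalize (∏ j ∈ Finset.range m, h (j + 1)) = Q at *
  obtain rfl : P = (h 1 ^ (m + 2))⁻¹ * (h (m + 1) ^ 2 * Q) := by
    rw [← habel, inv_mul_cancel_left]
  apply Additive.ofMul.injective
  simp only [mul_pow, inv_pow, pow_succ, pow_zero, mul_inv, ofMul_mul, ofMul_inv, ofMul_one]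
  abel
end
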